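/- Let α > 0 and p = 1 + 2/α, and let u : ℝⁿ × (0,∞) → ℝ be a nonnegative classical solution (C² in the space variable and C¹ in the time variable on ℝⁿ × (0,∞), continuous up to t = 0) of u_t = Δu + u^p V on ℝⁿ × (0,∞), where V : ℝⁿ × (0,∞) → ℝ is continuous and positive and satisfies the conditions (VOL) with exponent α. Then the integral ∫_{ℝⁿ × (0,∞)} V(x,t) u(x,t)^p dx dt is finite. -/

import Mathlib

open MeasureTheory Real Set

/-- The Laplacian in the space variables on Euclidean space: the sum of the pure second
directional derivatives along the standard coordinate directions. -/
noncomputable def laplacian {n : ℕ} (f : EuclideanSpace ℝ (Fin n) → ℝ)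
    (x : EuclideanSpace ℝ (Fin n)) : ℝ :=
  ∑ i, fderiv ℝ (fun y => fderiv ℝ f y (EuclideanSpace.single i 1)) x (EuclideanSpace.single i 1)

open Filter Topology

lemma second_deriv_nonneg_of_isLocalMin {g g' : ℝ → ℝ} {g2 : ℝ} (hmin : IsLocalMin g 0)
    (h1 : ∀ s, HasDerivAt g (g' s) s) (h2 : HasDerivAt g' g2 0) : 0 ≤ g2 := by
  by_contra hneg
  push Not at hneg
  have hd : deriv g = g' := funext fun s => (h1 s).deriv
  have h0 : g' 0 = 0 := hmin.hasDerivAt_eq_zero (h1 0)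
  have hmax : IsLocalMax g 0 := isLocalMax_of_deriv_deriv_neg (by rw [hd, h2.deriv]; exact hneg)
    (by rw [hd, h0]) (h1 0).continuousAt
  have hc : g =ᶠ[𝓝 0] fun _ => g 0 := by
    filter_upwards [hmin, hmax] with s a b using le_antisymm b a
  have hd0 : g' =ᶠ[𝓝 0] fun _ => 0 := by
    rw [← hd]
    have := hc.deriv
    refine this.trans ?_
    simp
  have : deriv g' 0 = 0 := by rw [hd0.deriv_eq]; simp
  rw [h2.deriv] at this
  linarith

lemma laplacian_ge_of_isLocalMin {n : ℕ} {v : EuclideanSpace ℝ (Fin n) → ℝ}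
    (hv : ContDiff ℝ 2 v) (M : ℝ) (l : EuclideanSpace ℝ (Fin n) →L[ℝ] ℝ)
    (x0 x : EuclideanSpace ℝ (Fin n))
    (hmin : IsLocalMin (fun y => v y - l y + M * ‖y - x0‖ ^ 2) x) :
    -(2 * n * M) ≤ laplacian v x := by
  have key : ∀ i : Fin n, -(2 * M) ≤
      fderiv ℝ (fun y => fderiv ℝ v y (EuclideanSpace.single i 1)) x
        (EuclideanSpace.single i 1) := by
    intro i
    set e : EuclideanSpace ℝ (Fin n) := EuclideanSpace.single i 1 with he
    have hne : ‖e‖ = 1 := by simp [he]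
    have hline : ∀ s : ℝ, HasDerivAt (fun s : ℝ => x + s • e) e s := by
      intro s
      simpa using ((hasDerivAt_id s).smul_const e).const_add x
    have hvd : Differentiable ℝ v := hv.differentiable (by norm_num)
    have hf1 : ContDiff ℝ 1 (fderiv ℝ v) := hv.fderiv_right (by norm_num)
    have hf2 : Differentiable ℝ (fun y => fderiv ℝ v y e) :=
      (hf1.differentiable (by norm_num)).clm_apply (differentiable_const _)
    have h1 : ∀ s : ℝ, HasDerivAt
        (fun s : ℝ => v (x + s • e) - l (x + s • e) + M * ‖x + s • e - x0‖ ^ 2)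
        (fderiv ℝ v (x + s • e) e - l e + M * (2 * inner ℝ (x + s • e - x0) e)) s := by
      intro s
      have a := (hvd (x + s • e)).hasFDerivAt.comp_hasDerivAt s (hline s)
      have b := l.hasFDerivAt.comp_hasDerivAt s (hline s)
      have c := ((hline s).sub_const x0).norm_sq
      exact (a.sub b).add (c.const_mul M)
    have h2 : HasDerivAt
        (fun s : ℝ => fderiv ℝ v (x + s • e) e - l e + M * (2 * inner ℝ (x + s • e - x0) e))
        (fderiv ℝ (fun y => fderiv ℝ v y e) x e + M * (2 * inner ℝ e e)) 0 := by
      have a := (hf2 (x + (0:ℝ) • e)).hasFDerivAt.comp_hasDerivAt (0:ℝ) (hline 0)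
      have c := ((hline 0).sub_const x0).inner ℝ (hasDerivAt_const (0:ℝ) e)
      have h3 := ((a.sub_const (l e)).add ((c.const_mul 2).const_mul M))
      have h4 := h3.congr_deriv (f' := _)
        (g' := fderiv ℝ (fun y => fderiv ℝ v y e) x e + M * (2 * inner ℝ e e)) (by simp)
      exact h4
    have hm : IsLocalMin (fun s : ℝ => v (x + s • e) - l (x + s • e) + M * ‖x + s • e - x0‖ ^ 2) 0 := by
      have hc : ContinuousAt (fun s : ℝ => x + s • e) 0 := (hline 0).continuousAt
      have hmin' : IsLocalMin (fun y => v y - l y + M * ‖y - x0‖ ^ 2) (x + (0:ℝ) • e) := by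
        simpa using hmin
      exact IsMinFilter.comp_tendsto (g := fun s : ℝ => x + s • e) hmin' hc
    have := second_deriv_nonneg_of_isLocalMin hm h1 h2
    rw [real_inner_self_eq_norm_sq, hne] at this
    linarith
  calc -(2 * n * M) = ∑ i : Fin n, -(2 * M) := by simp; ring
    _ ≤ _ := Finset.sum_le_sum fun i _ => key i


lemma deriv_nonpos_of_min_left {g : ℝ → ℝ} {g' a s : ℝ} (has : a < s) (hg : HasDerivAt g g' s)
    (hmin : ∀ z ∈ Icc a s, g s ≤ g z) : g' ≤ 0 := by
  have h := (hasDerivAt_iff_tendsto_slope.1 hg).mono_left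
    (nhdsWithin_mono s (fun y (hy : y < s) => hy.ne) : 𝓝[<] s ≤ 𝓝[≠] s)
  refine le_of_tendsto h ?_
  filter_upwards [Ioo_mem_nhdsLT has] with z hz
  rw [slope_def_field]
  exact div_nonpos_of_nonneg_of_nonpos (sub_nonneg.2 (hmin z ⟨hz.1.le, hz.2.le⟩))
    (by linarith [hz.2])

lemma lower_lipschitz {n : ℕ} {u : EuclideanSpace ℝ (Fin n) → ℝ → ℝ}
    (hu_cont : ContinuousOn (fun q : EuclideanSpace ℝ (Fin n) × ℝ => u q.1 q.2)
      {q : EuclideanSpace ℝ (Fin n) × ℝ | 0 ≤ q.2})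
    (hu_space : ∀ t : ℝ, 0 < t → ContDiff ℝ 2 (fun x => u x t))
    (hu_time : ∀ x, ∀ t : ℝ, 0 < t → DifferentiableAt ℝ (fun s => u x s) t)
    (hsup : ∀ x, ∀ t : ℝ, 0 < t → laplacian (fun y => u y t) x ≤ deriv (fun s => u x s) t)
    (x0 : EuclideanSpace ℝ (Fin n)) (R t : ℝ) (ht : 0 < t) :
    ∃ C k0 : ℝ, 0 < k0 ∧ ∀ x ∈ Metric.closedBall x0 R, ∀ z ∈ Ioo t (t + k0),
      -C * (z - t) ≤ u x z - u x t := by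
  set v : EuclideanSpace ℝ (Fin n) → ℝ := fun x => u x t with hvdef
  have hv := hu_space t ht
  have hvd : Differentiable ℝ v := hv.differentiable (by norm_num)
  have hf1 : ContDiff ℝ 1 (fderiv ℝ v) := hv.fderiv_right (by norm_num)
  have hf1d : Differentiable ℝ (fderiv ℝ v) := hf1.differentiable (by norm_num)
  have hcK : IsCompact (Metric.closedBall x0 (R + 1)) := isCompact_closedBall x0 (R + 1)
  obtain ⟨M0, hM0⟩ := hcK.exists_bound_of_continuousOn
    (f := fderiv ℝ (fderiv ℝ v)) (hf1.continuous_fderiv (by norm_num)).continuousOn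
  set M := max M0 0 with hMdef
  have hMnn : 0 ≤ M := le_max_right _ _
  have hsub : ∀ x ∈ Metric.closedBall x0 R, Metric.closedBall x 1 ⊆ Metric.closedBall x0 (R + 1) := by
    intro x hx
    apply Metric.closedBall_subset_closedBall'
    rw [Metric.mem_closedBall] at hx
    linarith
  have hlip : ∀ x ∈ Metric.closedBall x0 (R + 1), ∀ y ∈ Metric.closedBall x0 (R + 1),
      ‖fderiv ℝ v y - fderiv ℝ v x‖ ≤ M * ‖y - x‖ := by
    intro x hx y hy
    exact (convex_closedBall x0 (R + 1)).norm_image_sub_le_of_norm_fderiv_le (𝕜 := ℝ)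
      (fun z _ => hf1d z) (fun z hz => (hM0 z hz).trans (le_max_left _ _)) hx hy
  have htaylor : ∀ x ∈ Metric.closedBall x0 R, ∀ y ∈ Metric.closedBall x 1,
      v x - fderiv ℝ v x x - M * ‖y - x‖ ^ 2 ≤ v y - fderiv ℝ v x y := by
    intro x hx y hy
    have hyx : ‖y - x‖ ≤ 1 := by simpa [dist_eq_norm] using hy
    have := (convex_closedBall x ‖y - x‖).norm_image_sub_le_of_norm_fderiv_le' (𝕜 := ℝ)
      (f := v) (φ := fderiv ℝ v x) (C := M * ‖y - x‖) (x := x) (y := y)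
      (fun z _ => hvd z) (fun z hz => by
        have hz1 : z ∈ Metric.closedBall x 1 := Metric.closedBall_subset_closedBall hyx hz
        have hz2 : ‖z - x‖ ≤ ‖y - x‖ := by simpa [dist_eq_norm] using hz
        refine (hlip x (hsub x hx (Metric.mem_closedBall_self zero_le_one)) z (hsub x hx hz1)).trans ?_
        gcongr)
      (Metric.mem_closedBall_self (norm_nonneg _)) (by simp [dist_eq_norm])
    rw [Real.norm_eq_abs] at this
    have h2 := (abs_le.1 this).1
    rw [map_sub] at h2
    nlinarith
  -- uniform continuity in time
  have hunif : ∃ k0 : ℝ, 0 < k0 ∧ ∀ y ∈ Metric.closedBall x0 (R + 1), ∀ z ∈ Icc t (t + k0),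
      v y - 1 < u y z := by
    have hcS : IsCompact (Metric.closedBall x0 (R + 1) ×ˢ Icc t (t + 1)) := hcK.prod isCompact_Icc
    have huc := hcS.uniformContinuousOn_of_continuous
      (hu_cont.mono (by rintro ⟨y, z⟩ ⟨_, hz⟩; exact ht.le.trans hz.1))
    rw [Metric.uniformContinuousOn_iff] at huc
    obtain ⟨δ, hδ, hh⟩ := huc 1 one_pos
    refine ⟨min 1 (δ / 2), by positivity, ?_⟩
    intro y hy z hz
    have hm1 : min 1 (δ / 2) ≤ 1 := min_le_left _ _
    have hm2 : min 1 (δ / 2) ≤ δ / 2 := min_le_right _ _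
    have := hh (y, t) ⟨hy, le_rfl, by linarith⟩ (y, z) ⟨hy, hz.1, by linarith [hz.2]⟩ (by
      rw [Prod.dist_eq]
      simp only [dist_self, Real.dist_eq]
      rw [max_lt_iff]
      refine ⟨hδ, ?_⟩
      rw [abs_lt]; constructor <;> linarith [hz.1, hz.2])
    rw [Real.dist_eq] at this
    have := (abs_lt.1 this).2
    simp only [hvdef]
    linarith
  obtain ⟨k0, hk0, hunif⟩ := hunif
  set C := 2 * n * (M + 1) + 1 with hC
  have hCpos : 0 < C := by positivity
  refine ⟨C, k0, hk0, ?_⟩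
  intro x hx z1 hz1
  set l := fderiv ℝ v x with hl
  set g : EuclideanSpace ℝ (Fin n) × ℝ → ℝ := fun q =>
    u q.1 q.2 - l q.1 + (M + 1) * ‖q.1 - x‖ ^ 2 + C * (q.2 - t) with hg
  have hSc : IsCompact (Metric.closedBall x 1 ×ˢ Icc t z1) :=
    (isCompact_closedBall x 1).prod isCompact_Icc
  have hgc : ContinuousOn g (Metric.closedBall x 1 ×ˢ Icc t z1) := by
    have h1 : ContinuousOn (fun q : EuclideanSpace ℝ (Fin n) × ℝ => u q.1 q.2)
      (Metric.closedBall x 1 ×ˢ Icc t z1) :=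
      hu_cont.mono (by rintro ⟨y, z⟩ ⟨_, hz⟩; exact ht.le.trans hz.1)
    have h2 : Continuous (fun q : EuclideanSpace ℝ (Fin n) × ℝ => l q.1) :=
      l.continuous.comp continuous_fst
    have h3 : Continuous (fun q : EuclideanSpace ℝ (Fin n) × ℝ =>
      (M + 1) * ‖q.1 - x‖ ^ 2) := by fun_prop
    have h4 : Continuous (fun q : EuclideanSpace ℝ (Fin n) × ℝ => C * (q.2 - t)) := by fun_prop
    exact ((h1.sub h2.continuousOn).add h3.continuousOn).add h4.continuousOn
  have hxm : x ∈ Metric.closedBall x 1 := Metric.mem_closedBall_self zero_le_one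
  obtain ⟨⟨ys, ss⟩, ⟨hys, hss⟩, hmin⟩ := hSc.exists_isMinOn
    ⟨(x, z1), hxm, hz1.1.le, le_rfl⟩ hgc
  simp only at hys hss
  have hmin' : ∀ y ∈ Metric.closedBall x 1, ∀ s ∈ Icc t z1, g (ys, ss) ≤ g (y, s) :=
    fun y hy s hs => hmin (show (y, s) ∈ Metric.closedBall x 1 ×ˢ Icc t z1 from ⟨hy, hs⟩)
  have hbase : v x - l x ≤ g (ys, ss) := by
    have hT := htaylor x hx ys hys
    have hsst : 0 ≤ C * (ss - t) := mul_nonneg hCpos.le (sub_nonneg.2 hss.1)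
    rcases eq_or_lt_of_le hss.1 with hst | hst
    · simp only [hg, ← hst]
      have : v ys = u ys t := rfl
      nlinarith [sq_nonneg ‖ys - x‖]
    · rcases eq_or_lt_of_le (show ‖ys - x‖ ≤ 1 by simpa [dist_eq_norm] using hys) with hyb | hyb
      · have h1 := hunif ys (hsub x hx hys) ss ⟨hss.1, hss.2.trans hz1.2.le⟩
        simp only [hg]
        rw [hyb] at hT ⊢
        nlinarith
      · exfalso
        have hspos : 0 < ss := ht.trans hst
        have hd : deriv (fun s => u ys s) ss + C ≤ 0 := by
          have hD : HasDerivAt (fun s => g (ys, s)) (deriv (fun s => u ys s) ss + C) ss := by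
            have a := (hu_time ys ss hspos).hasDerivAt
            have b := ((hasDerivAt_id ss).sub_const t).const_mul C
            have c := ((a.sub_const (l ys)).add_const ((M + 1) * ‖ys - x‖ ^ 2)).add b
            exact c.congr_deriv (by simp)
          exact deriv_nonpos_of_min_left hst hD
            (fun z hz => hmin' ys hys z ⟨hz.1, hz.2.trans hss.2⟩)
        have hlap := laplacian_ge_of_isLocalMin (hu_space ss hspos) (M + 1) l x ys (by
          have hnb : Metric.closedBall x 1 ∈ 𝓝 ys :=
            mem_of_superset (Metric.isOpen_ball.mem_nhds (by simpa [dist_eq_norm] using hyb))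
              Metric.ball_subset_closedBall
          filter_upwards [hnb] with y hy
          have := hmin' y hy ss hss
          simp only [hg] at this
          linarith)
        have := hsup ys ss hspos
        rw [hC] at hd
        linarith
  have hfin := hmin' x hxm z1 ⟨hz1.1.le, le_rfl⟩
  have : g (x, z1) = u x z1 - l x + C * (z1 - t) := by simp [hg]
  have hvx : v x = u x t := rfl
  rw [this] at hfin
  linarith


lemma hasDerivAt_posPart_pow (k : ℕ) (hk : 2 ≤ k) (s : ℝ) :
    HasDerivAt (fun s : ℝ => max s 0 ^ k) (k * max s 0 ^ (k - 1)) s := by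
  rcases lt_trichotomy s 0 with h | h | h
  · rw [max_eq_right h.le, zero_pow (by omega), mul_zero]
    refine (hasDerivAt_const s (0:ℝ)).congr_of_eventuallyEq ?_
    filter_upwards [Iio_mem_nhds h] with y hy
    rw [max_eq_right (le_of_lt hy), zero_pow (by omega)]
  · subst h
    have : (fun s : ℝ => max s 0 ^ k) =O[𝓝 0] fun x => ‖x - 0‖ ^ k := by
      refine Asymptotics.IsBigO.of_bound 1 (Eventually.of_forall fun y => ?_)
      rw [one_mul, sub_zero, norm_pow, norm_pow, norm_norm]
      refine pow_le_pow_left₀ (norm_nonneg _) ?_ k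
      rw [Real.norm_eq_abs, Real.norm_eq_abs, abs_of_nonneg (le_max_right _ _)]
      exact max_le (le_abs_self y) (abs_nonneg y)
    have h2 := (this.hasFDerivAt (𝕜 := ℝ) (by omega : 1 < k)).hasDerivAt
    refine h2.congr_deriv ?_
    simp [zero_pow (show k - 1 ≠ 0 by omega)]
  · rw [max_eq_left h.le]
    refine (hasDerivAt_pow k s).congr_of_eventuallyEq ?_
    filter_upwards [Ioi_mem_nhds h] with y hy
    rw [max_eq_left (le_of_lt hy)]

/-- The profile `(1 - |x - x₀|²/R²)₊`. -/
noncomputable def prof {n : ℕ} (x0 : EuclideanSpace ℝ (Fin n)) (R : ℝ)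
    (x : EuclideanSpace ℝ (Fin n)) : ℝ := max (1 - ‖x - x0‖ ^ 2 / R ^ 2) 0

lemma prof_continuous {n : ℕ} (x0 : EuclideanSpace ℝ (Fin n)) (R : ℝ) :
    Continuous (prof x0 R) := by
  unfold prof; fun_prop

lemma prof_nonneg {n : ℕ} (x0 : EuclideanSpace ℝ (Fin n)) (R : ℝ) (x) : 0 ≤ prof x0 R x :=
  le_max_right _ _

lemma prof_le_one {n : ℕ} (x0 : EuclideanSpace ℝ (Fin n)) (R : ℝ) (x) : prof x0 R x ≤ 1 :=
  max_le (by have : 0 ≤ ‖x - x0‖ ^ 2 / R ^ 2 := by positivity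
             linarith) zero_le_one

lemma prof_eq_zero {n : ℕ} {x0 : EuclideanSpace ℝ (Fin n)} {R : ℝ} (hR : 0 < R)
    {x} (hx : x ∉ Metric.ball x0 R) : prof x0 R x = 0 := by
  refine max_eq_right ?_
  have h : R ≤ ‖x - x0‖ := by simpa [dist_eq_norm] using hx
  rw [sub_nonpos, le_div_iff₀ (by positivity), one_mul]
  gcongr

lemma prof_eq_zero' {n : ℕ} {x0 : EuclideanSpace ℝ (Fin n)} {R : ℝ} (hR : 0 < R)
    {x} (hx : x ∉ Metric.closedBall x0 R) : prof x0 R x = 0 :=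
  prof_eq_zero hR fun h => hx (Metric.ball_subset_closedBall h)

lemma integrable_of_zero_off {n : ℕ} {x0 : EuclideanSpace ℝ (Fin n)} {R : ℝ}
    {w : EuclideanSpace ℝ (Fin n) → ℝ} (hw : Continuous w)
    (h0 : ∀ x ∉ Metric.closedBall x0 R, w x = 0) : Integrable w :=
  hw.integrable_of_hasCompactSupport (HasCompactSupport.intro (isCompact_closedBall x0 R) h0)

lemma hasDerivAt_prof_line {n : ℕ} (x0 : EuclideanSpace ℝ (Fin n)) (R : ℝ)
    (x : EuclideanSpace ℝ (Fin n)) (i : Fin n) (k : ℕ) (hk : 2 ≤ k) :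
    HasDerivAt (fun s : ℝ => prof x0 R (x + s • EuclideanSpace.single i 1) ^ k)
      (k * prof x0 R x ^ (k - 1) * (-(2 * (x i - x0 i) / R ^ 2))) 0 := by
  set e : EuclideanSpace ℝ (Fin n) := EuclideanSpace.single i 1 with he
  have hline : HasDerivAt (fun s : ℝ => x + s • e - x0) e 0 := by
    simpa using (((hasDerivAt_id (0:ℝ)).smul_const e).const_add x).sub_const x0
  have h1 := (hline.norm_sq.div_const (R ^ 2)).const_sub 1
  have h2 := (hasDerivAt_posPart_pow k hk (1 - ‖x + (0:ℝ) • e - x0‖ ^ 2 / R ^ 2)).comp (0:ℝ) h1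
  refine h2.congr_deriv ?_
  simp [prof, he, EuclideanSpace.inner_single_right]

lemma lap_prof_ineq {N m : ℝ} (Y R : ℝ) (hR : 0 < R)
    (hm : m = max (1 - Y / R ^ 2) 0) :
    -((4 + N) ^ 2 / R ^ 2) * m ^ 3 ≤ 24 * m / R ^ 4 * Y - N * (6 / R ^ 2 * m ^ 2) := by
  rcases le_total (1 - Y / R ^ 2) 0 with h | h
  · rw [max_eq_right h] at hm
    subst hm; simp
  · rw [max_eq_left h] at hm
    have hY : Y = R ^ 2 * (1 - m) := by rw [hm]; field_simp; ring
    have hm0 : 0 ≤ m := hm ▸ h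
    have : 24 * m / R ^ 4 * Y - N * (6 / R ^ 2 * m ^ 2) - -((4 + N) ^ 2 / R ^ 2) * m ^ 3
      = m / R ^ 2 * (((4 + N) * m - 3) ^ 2 + 15) := by
      rw [hY]; field_simp; ring
    have h2 : 0 ≤ m / R ^ 2 * (((4 + N) * m - 3) ^ 2 + 15) := by positivity
    linarith

lemma integral_laplacian_ge {n : ℕ} (x0 : EuclideanSpace ℝ (Fin n)) {R : ℝ} (hR : 0 < R)
    {v : EuclideanSpace ℝ (Fin n) → ℝ} (hv : ContDiff ℝ 2 v) (hv0 : ∀ x, 0 ≤ v x) :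
    -((4 + n) ^ 2 / R ^ 2) * ∫ x, v x * prof x0 R x ^ 3 ≤
      ∫ x, laplacian v x * prof x0 R x ^ 3 := by
  have hvc : Continuous v := hv.continuous
  have hvd : Differentiable ℝ v := hv.differentiable (by norm_num)
  have hf1 : ContDiff ℝ 1 (fderiv ℝ v) := hv.fderiv_right (by norm_num)
  have hg1 : ∀ e : EuclideanSpace ℝ (Fin n), ContDiff ℝ 1 (fun y => fderiv ℝ v y e) :=
    fun e => hf1.clm_apply contDiff_const
  have hg1c : ∀ e : EuclideanSpace ℝ (Fin n), Continuous (fun y => fderiv ℝ v y e) :=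
    fun e => (hg1 e).continuous
  have hg2c : ∀ e : EuclideanSpace ℝ (Fin n),
      Continuous (fun x => fderiv ℝ (fun y => fderiv ℝ v y e) x e) :=
    fun e => ((hg1 e).continuous_fderiv (by norm_num)).clm_apply continuous_const
  have hpc := prof_continuous x0 R
  have hci : ∀ i : Fin n, Continuous (fun x : EuclideanSpace ℝ (Fin n) => x i - x0 i) := by
    intro i; fun_prop
  set P : Fin n → EuclideanSpace ℝ (Fin n) → ℝ := fun i x =>
    3 * prof x0 R x ^ 2 * (-(2 * (x i - x0 i) / R ^ 2)) with hP
  set Q : Fin n → EuclideanSpace ℝ (Fin n) → ℝ := fun i x =>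
    24 * prof x0 R x / R ^ 4 * (x i - x0 i) ^ 2 - 6 / R ^ 2 * prof x0 R x ^ 2 with hQ
  have hPc : ∀ i, Continuous (P i) := by
    intro i
    have := hci i
    simp only [hP]; fun_prop
  have hQc : ∀ i, Continuous (Q i) := by
    intro i
    have := hci i
    simp only [hQ]; fun_prop
  have hP0 : ∀ i, ∀ x ∉ Metric.closedBall x0 R, P i x = 0 := by
    intro i x hx; simp [hP, prof_eq_zero' hR hx]
  have hQ0 : ∀ i, ∀ x ∉ Metric.closedBall x0 R, Q i x = 0 := by
    intro i x hx; simp [hQ, prof_eq_zero' hR hx]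
  have hvl : ∀ (w : EuclideanSpace ℝ (Fin n) → ℝ) (e x : EuclideanSpace ℝ (Fin n)),
      Differentiable ℝ w → HasLineDerivAt ℝ w (fderiv ℝ w x e) x e :=
    fun w e x hw => (hw x).hasFDerivAt.hasLineDerivAt e
  have hφl : ∀ i x, HasLineDerivAt ℝ (fun x => prof x0 R x ^ 3) (P i x) x
      (EuclideanSpace.single i 1) := by
    intro i x
    have := hasDerivAt_prof_line x0 R x i 3 (by norm_num)
    refine HasDerivAt.congr_deriv this ?_
    simp [hP]
  have hPl : ∀ i x, HasLineDerivAt ℝ (P i) (Q i x) x (EuclideanSpace.single i 1) := by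
    intro i x
    have h1 := hasDerivAt_prof_line x0 R x i 2 (by norm_num)
    have h2 : HasDerivAt (fun s : ℝ =>
        -(2 * ((x + s • (EuclideanSpace.single i 1 : EuclideanSpace ℝ (Fin n))) i - x0 i) / R ^ 2))
        (-(2 / R ^ 2)) 0 := by
      have : (fun s : ℝ =>
        -(2 * ((x + s • (EuclideanSpace.single i 1 : EuclideanSpace ℝ (Fin n))) i - x0 i) / R ^ 2))
        = fun s : ℝ => -(2 * (x i + s - x0 i) / R ^ 2) := by
        funext s; simp
      rw [this]
      have := (((((hasDerivAt_id (0:ℝ)).const_add (x i)).sub_const (x0 i)).const_mul 2).div_const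
        (R ^ 2)).neg
      exact this.congr_deriv (by simp)
    have h3 := (h1.const_mul 3).mul h2
    refine HasDerivAt.congr_deriv h3 ?_
    simp [hQ]
    field_simp
    ring
  have hibp : ∀ i, ∫ x, prof x0 R x ^ 3 *
      fderiv ℝ (fun y => fderiv ℝ v y (EuclideanSpace.single i 1)) x (EuclideanSpace.single i 1)
      = ∫ x, Q i x * v x := by
    intro i
    set e : EuclideanSpace ℝ (Fin n) := EuclideanSpace.single i 1 with he
    have hφ0 : ∀ x ∉ Metric.closedBall x0 R, prof x0 R x ^ 3 = 0 := by
      intro x hx; simp [prof_eq_zero' hR hx]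
    have e1 := integral_bilinear_hasLineDerivAt_right_eq_neg_left_of_integrable (μ := volume)
      (f := fun x => prof x0 R x ^ 3) (f' := P i) (g := fun y => fderiv ℝ v y e)
      (g' := fun x => fderiv ℝ (fun y => fderiv ℝ v y e) x e) (v := e)
      (B := ContinuousLinearMap.mul ℝ ℝ)
      (integrable_of_zero_off (x0 := x0) (R := R) ((hPc i).mul (hg1c e))
        (fun x hx => by simp [hP0 i x hx]))
      (integrable_of_zero_off (x0 := x0) (R := R) ((hpc.pow 3).mul (hg2c e))
        (fun x hx => by simp [prof_eq_zero' hR hx]))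
      (integrable_of_zero_off (x0 := x0) (R := R) ((hpc.pow 3).mul (hg1c e))
        (fun x hx => by simp [prof_eq_zero' hR hx]))
      (fun x _ => hφl i x)
      (fun x _ => hvl _ e x ((hg1 e).differentiable (by norm_num)))
    have e2 := integral_bilinear_hasLineDerivAt_right_eq_neg_left_of_integrable (μ := volume)
      (f := P i) (f' := Q i) (g := v)
      (g' := fun x => fderiv ℝ v x e) (v := e)
      (B := ContinuousLinearMap.mul ℝ ℝ)
      (integrable_of_zero_off (x0 := x0) (R := R) ((hQc i).mul hvc)
        (fun x hx => by simp [hQ0 i x hx]))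
      (integrable_of_zero_off (x0 := x0) (R := R) ((hPc i).mul (hg1c e))
        (fun x hx => by simp [hP0 i x hx]))
      (integrable_of_zero_off (x0 := x0) (R := R) ((hPc i).mul hvc)
        (fun x hx => by simp [hP0 i x hx]))
      (fun x _ => hPl i x)
      (fun x _ => hvl _ e x hvd)
    simp only [ContinuousLinearMap.mul_apply'] at e1 e2
    rw [e1, e2, neg_neg]
  have hsum : ∫ x, laplacian v x * prof x0 R x ^ 3 = ∫ x, (∑ i, Q i x) * v x := by
    have l1 : (fun x => laplacian v x * prof x0 R x ^ 3) = fun x => ∑ i : Fin n,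
        prof x0 R x ^ 3 * fderiv ℝ (fun y => fderiv ℝ v y (EuclideanSpace.single i 1)) x
          (EuclideanSpace.single i 1) := by
      funext x
      rw [laplacian, Finset.sum_mul]
      exact Finset.sum_congr rfl fun i _ => mul_comm _ _
    have l2 : (fun x => (∑ i, Q i x) * v x) = fun x => ∑ i, Q i x * v x := by
      funext x; rw [Finset.sum_mul]
    rw [l1, l2, integral_finsetSum, integral_finsetSum]
    · exact Finset.sum_congr rfl fun i _ => hibp i
    · intro i _
      exact integrable_of_zero_off (x0 := x0) (R := R) ((hQc i).mul hvc)
        (fun x hx => by simp [hQ0 i x hx])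
    · intro i _
      exact integrable_of_zero_off (x0 := x0) (R := R) ((hpc.pow 3).mul (hg2c _))
        (fun x hx => by simp [prof_eq_zero' hR hx])
  rw [hsum, ← integral_const_mul]
  refine integral_mono ?_ ?_ ?_
  · exact integrable_of_zero_off (x0 := x0) (R := R) (continuous_const.mul (hvc.mul (hpc.pow 3)))
        (fun x hx => by simp [prof_eq_zero' hR hx])
  · exact integrable_of_zero_off (x0 := x0) (R := R)
        ((continuous_finsetSum _ fun i _ => hQc i).mul hvc)
        (fun x hx => by simp [hQ0 _ x hx])
  · intro x
    have hs : ∑ i, Q i x = 24 * prof x0 R x / R ^ 4 * ‖x - x0‖ ^ 2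
        - n * (6 / R ^ 2 * prof x0 R x ^ 2) := by
      simp only [hQ]
      rw [Finset.sum_sub_distrib, ← Finset.mul_sum, EuclideanSpace.real_norm_sq_eq]
      simp
    have := lap_prof_ineq (N := n) (m := prof x0 R x) (‖x - x0‖ ^ 2) R hR rfl
    have h2 := mul_le_mul_of_nonneg_right this (hv0 x)
    simp only [hs]
    linarith


lemma dini_lower {n : ℕ} {u : EuclideanSpace ℝ (Fin n) → ℝ → ℝ}
    (hu_cont : ContinuousOn (fun q : EuclideanSpace ℝ (Fin n) × ℝ => u q.1 q.2)
      {q : EuclideanSpace ℝ (Fin n) × ℝ | 0 ≤ q.2})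
    (hu_space : ∀ t : ℝ, 0 < t → ContDiff ℝ 2 (fun x => u x t))
    (hu_time : ∀ x, ∀ t : ℝ, 0 < t → DifferentiableAt ℝ (fun s => u x s) t)
    (hsup : ∀ x, ∀ t : ℝ, 0 < t → laplacian (fun y => u y t) x ≤ deriv (fun s => u x s) t)
    (x0 : EuclideanSpace ℝ (Fin n)) {R t : ℝ} (hR : 0 < R) (ht : 0 < t)
    (hutc : Continuous (fun x => deriv (fun s => u x s) t)) (r : ℝ)
    (hr : r < ∫ x, deriv (fun s => u x s) t * prof x0 R x ^ 3) :
    ∀ᶠ z in 𝓝[>] t, r < slope (fun s => ∫ x, u x s * prof x0 R x ^ 3) t z := by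
  obtain ⟨C, k0, hk0, hlow⟩ := lower_lipschitz hu_cont hu_space hu_time hsup x0 R t ht
  have hpc := prof_continuous x0 R
  have huc : ∀ s, 0 < s → Continuous (fun x => u x s) := fun s hs => (hu_space s hs).continuous
  have hslc : ∀ z, t < z → Continuous (fun x => slope (fun s => u x s) t z) := by
    intro z hz
    simp only [slope_def_field]
    exact ((huc z (ht.trans hz)).sub (huc t ht)).div_const _
  have hmem : ∀ᶠ z in 𝓝[>] t, z ∈ Ioo t (t + k0) := Ioo_mem_nhdsGT (by linarith)
  have hlim : Tendsto (fun z => ∫ x, min (slope (fun s => u x s) t z) (deriv (fun s => u x s) t)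
      * prof x0 R x ^ 3) (𝓝[>] t) (𝓝 (∫ x, deriv (fun s => u x s) t * prof x0 R x ^ 3)) := by
    refine tendsto_integral_filter_of_dominated_convergence
      (fun x => (|C| + |deriv (fun s => u x s) t|) * prof x0 R x ^ 3) ?_ ?_ ?_ ?_
    · filter_upwards [hmem] with z hz
      exact (((hslc z hz.1).min hutc).mul (hpc.pow 3)).aestronglyMeasurable
    · filter_upwards [hmem] with z hz
      refine Eventually.of_forall fun x => ?_
      by_cases hx : x ∈ Metric.closedBall x0 R
      · have hp0 : 0 ≤ prof x0 R x ^ 3 := pow_nonneg (prof_nonneg _ _ _) 3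
        rw [norm_mul, Real.norm_of_nonneg hp0]
        refine mul_le_mul_of_nonneg_right ?_ hp0
        have h1 : -C ≤ slope (fun s => u x s) t z := by
          rw [slope_def_field, le_div_iff₀ (by linarith [hz.1])]
          exact hlow x hx z hz
        rw [Real.norm_eq_abs, abs_le]
        constructor
        · refine le_min ?_ ?_
          · linarith [le_abs_self C, abs_nonneg (deriv (fun s => u x s) t)]
          · linarith [neg_abs_le (deriv (fun s => u x s) t), abs_nonneg C]
        · refine (min_le_right _ _).trans ?_
          linarith [le_abs_self (deriv (fun s => u x s) t), abs_nonneg C]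
      · simp [prof_eq_zero' hR hx]
    · exact integrable_of_zero_off (x0 := x0) (R := R)
        ((continuous_const.add hutc.abs).mul (hpc.pow 3))
        (fun x hx => by simp [prof_eq_zero' hR hx])
    · refine Eventually.of_forall fun x => ?_
      have h1 : Tendsto (slope (fun s => u x s) t) (𝓝[>] t) (𝓝 (deriv (fun s => u x s) t)) :=
        (hasDerivAt_iff_tendsto_slope.1 (hu_time x t ht).hasDerivAt).mono_left
          (nhdsWithin_mono t (fun y (hy : t < y) => hy.ne'))
      have h2 := (h1.min (tendsto_const_nhds (x := deriv (fun s => u x s) t))).mul_const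
        (prof x0 R x ^ 3)
      simpa using h2
  filter_upwards [hlim.eventually_const_lt hr, hmem] with z hz hzm
  refine hz.trans_le ?_
  have hz0 : 0 < z := ht.trans hzm.1
  have hInteg : ∀ s, 0 < s → Integrable (fun x => u x s * prof x0 R x ^ 3) := fun s hs =>
    integrable_of_zero_off (x0 := x0) (R := R) ((huc s hs).mul (hpc.pow 3))
        (fun x hx => by simp [prof_eq_zero' hR hx])
  have hsl : slope (fun s => ∫ x, u x s * prof x0 R x ^ 3) t z
      = ∫ x, slope (fun s => u x s) t z * prof x0 R x ^ 3 := by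
    rw [slope_def_field, ← integral_sub (hInteg z hz0) (hInteg t ht), ← integral_div]
    congr 1
    funext x
    rw [slope_def_field]; ring
  rw [hsl]
  refine integral_mono ?_ ?_ ?_
  · exact integrable_of_zero_off (x0 := x0) (R := R)
        (((hslc z hzm.1).min hutc).mul (hpc.pow 3))
        (fun x hx => by simp [prof_eq_zero' hR hx])
  · exact integrable_of_zero_off (x0 := x0) (R := R)
        ((hslc z hzm.1).mul (hpc.pow 3))
        (fun x hx => by simp [prof_eq_zero' hR hx])
  · intro x
    exact mul_le_mul_of_nonneg_right (min_le_left _ _) (pow_nonneg (prof_nonneg _ _ _) 3)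

lemma weight_ineq {F H w w' L : ℝ → ℝ} {a b : ℝ} (ha : 0 < a) (hab : a ≤ b)
    (hF : ContinuousOn F (Ioi 0))
    (hd : ∀ t, 0 < t → ∀ r, r < H t → ∀ᶠ z in 𝓝[>] t, r < slope F t z)
    (hw : ∀ t, HasDerivAt w (w' t) t) (hw0 : ∀ t ∈ Icc a b, 0 ≤ w t)
    (hL : ContinuousOn L (Ioi 0))
    (hLle : ∀ t ∈ Ico a b, L t ≤ w t * H t + w' t * F t) :
    ∫ t in a..b, L t ≤ w b * F b - w a * F a := by
  have hpos : Icc a b ⊆ Ioi 0 := fun t ht => ha.trans_le ht.1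
  have hwc : Continuous w := continuous_iff_continuousAt.2 fun t => (hw t).continuousAt
  have hB : ∀ t ∈ Icc a b, HasDerivAt (fun z => -(w a * F a) - ∫ s in a..z, L s) (-L t) t := by
    intro t ht
    have h1 : IntervalIntegrable L volume a t :=
      (hL.mono (by rw [uIcc_of_le ht.1]; exact fun s hs => ha.trans_le hs.1)).intervalIntegrable
    have h2 := intervalIntegral.integral_hasDerivAt_right h1
      (hL.stronglyMeasurableAtFilter isOpen_Ioi t (hpos ht))
      (hL.continuousAt (isOpen_Ioi.mem_nhds (hpos ht)))
    exact h2.const_sub _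
  have := image_le_of_liminf_slope_right_le_deriv_boundary (f := fun t => -(w t * F t))
    (a := a) (b := b) ((hwc.continuousOn.mul (hF.mono hpos)).neg)
    (B := fun z => -(w a * F a) - ∫ s in a..z, L s) (B' := fun t => -L t) (by simp)
    (fun t ht => (hB t ht).continuousAt.continuousWithinAt)
    (fun t ht => (hB t ⟨ht.1, ht.2.le⟩).hasDerivWithinAt) (by
      intro x hx r hr
      apply Eventually.frequently
      have hx0 : 0 < x := ha.trans_le hx.1
      have hlt : -r < w x * H x + w' x * F x := by linarith [hLle x hx]
      have hh : ∃ h, h < H x ∧ -r < w x * h + w' x * F x := by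
        have hc : Tendsto (fun h => w x * h + w' x * F x) (𝓝[<] (H x))
            (𝓝 (w x * H x + w' x * F x)) := by
          apply Tendsto.mono_left _ nhdsWithin_le_nhds
          exact (by fun_prop : Continuous (fun h => w x * h + w' x * F x)).tendsto _
        obtain ⟨h, h1, h2⟩ := ((hc.eventually_const_lt hlt).and self_mem_nhdsWithin).exists
        exact ⟨h, h2, h1⟩
      obtain ⟨h, hh1, hh2⟩ := hh
      have hsw : Tendsto (slope w x) (𝓝[>] x) (𝓝 (w' x)) :=
        (hasDerivAt_iff_tendsto_slope.1 (hw x)).mono_left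
          (nhdsWithin_mono x (fun y (hy : x < y) => hy.ne'))
      have hlim : Tendsto (fun z => w z * h + slope w x z * F x) (𝓝[>] x)
          (𝓝 (w x * h + w' x * F x)) :=
        (((hwc.tendsto x).mono_left nhdsWithin_le_nhds).mul_const h).add (hsw.mul_const (F x))
      filter_upwards [hd x hx0 h hh1, hlim.eventually_const_lt hh2, Ioo_mem_nhdsGT hx.2]
        with z hz1 hz2 hz3
      have hwz := hw0 z ⟨hx.1.trans hz3.1.le, hz3.2.le⟩
      have hne : z - x ≠ 0 := (sub_pos.2 hz3.1).ne'
      have e : slope (fun t => -(w t * F t)) x z = -(w z * slope F x z + slope w x z * F x) := by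
        simp only [slope_def_field]
        field_simp
        ring
      rw [e]
      have := mul_le_mul_of_nonneg_left hz1.le hwz
      linarith)
  have h2 := this (right_mem_Icc.2 hab)
  linarith

lemma young_pointwise {p q u V χ c : ℝ} (hpq : p.HolderConjugate q) (hu : 0 ≤ u) (hV : 0 < V)
    (hχ : 0 ≤ χ) (hc : 0 ≤ c) :
    c * χ ^ (q - 1) * u - χ ^ q * (u ^ p * V) ≤ c ^ q * V ^ (-(1 / (p - 1))) := by
  have hp := hpq.lt
  have hq := hpq.symm.lt
  have hp0 := hpq.pos
  have hq0 := hpq.symm.pos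
  have e1 : (q - 1) * p = q := by
    have := hpq.mul_eq_add; linarith
  have e2 : -(1 / p) * q = -(1 / (p - 1)) := by
    have : p - 1 ≠ 0 := by linarith
    have h3 : q = p / (p - 1) := hpq.conjugate_eq
    rw [h3]; field_simp
  have y := Real.young_inequality_of_nonneg (a := u * V ^ (1 / p) * χ ^ (q - 1))
    (b := c * V ^ (-(1 / p))) (by positivity) (by positivity) hpq
  have l : u * V ^ (1 / p) * χ ^ (q - 1) * (c * V ^ (-(1 / p))) = c * χ ^ (q - 1) * u := by
    have : V ^ (1 / p) * V ^ (-(1 / p)) = 1 := by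
      rw [← Real.rpow_add hV]; simp
    calc _ = c * χ ^ (q - 1) * u * (V ^ (1 / p) * V ^ (-(1 / p))) := by ring
      _ = _ := by rw [this, mul_one]
  have r1 : (u * V ^ (1 / p) * χ ^ (q - 1)) ^ p = χ ^ q * (u ^ p * V) := by
    rw [Real.mul_rpow (by positivity) (by positivity), Real.mul_rpow hu (by positivity),
      ← Real.rpow_mul hV.le, ← Real.rpow_mul hχ, e1, one_div, inv_mul_cancel₀ hp0.ne',
      Real.rpow_one]
    ring
  have r2 : (c * V ^ (-(1 / p))) ^ q = c ^ q * V ^ (-(1 / (p - 1))) := by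
    rw [Real.mul_rpow hc (by positivity), ← Real.rpow_mul hV.le, e2]
  rw [l, r1, r2] at y
  have d1 : χ ^ q * (u ^ p * V) / p ≤ χ ^ q * (u ^ p * V) :=
    div_le_self (by positivity) hp.le
  have d2 : c ^ q * V ^ (-(1 / (p - 1))) / q ≤ c ^ q * V ^ (-(1 / (p - 1))) :=
    div_le_self (by positivity) hq.le
  linarith


lemma core_bound {n : ℕ} (p q : ℝ) (hpq : p.HolderConjugate q)
    (u V : EuclideanSpace ℝ (Fin n) → ℝ → ℝ)
    (hu_cont : ContinuousOn (fun q : EuclideanSpace ℝ (Fin n) × ℝ => u q.1 q.2)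
      {q : EuclideanSpace ℝ (Fin n) × ℝ | 0 ≤ q.2})
    (hu_space : ∀ t : ℝ, 0 < t → ContDiff ℝ 2 (fun x => u x t))
    (hu_time : ∀ x, ∀ t : ℝ, 0 < t → DifferentiableAt ℝ (fun s => u x s) t)
    (hV_cont : ContinuousOn (fun q : EuclideanSpace ℝ (Fin n) × ℝ => V q.1 q.2)
      {q : EuclideanSpace ℝ (Fin n) × ℝ | 0 < q.2})
    (hV_pos : ∀ x, ∀ t : ℝ, 0 < t → 0 < V x t)
    (hu_nonneg : ∀ x, ∀ t : ℝ, 0 ≤ t → 0 ≤ u x t)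
    (hpde : ∀ x, ∀ t : ℝ, 0 < t →
      deriv (fun s => u x s) t = laplacian (fun y => u y t) x + u x t ^ p * V x t)
    (hf_cont : ContinuousOn (fun q : EuclideanSpace ℝ (Fin n) × ℝ => u q.1 q.2 ^ p * V q.1 q.2)
      {q : EuclideanSpace ℝ (Fin n) × ℝ | 0 < q.2})
    (x0 : EuclideanSpace ℝ (Fin n)) {R ε : ℝ} (hR : 0 < R) (hε : 0 < ε) (hεR : ε ≤ R ^ 2 / 4) :
    ∫ t in ε..(R ^ 2 / 4), ∫ x, (u x t ^ p * V x t) * prof x0 R x ^ 3 ≤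
      Real.exp ((4 + n) ^ 2) * ((q / (R ^ 2 - R ^ 2 / 4)) ^ q *
        ∫ t in Ioc (R ^ 2 / 4) (R ^ 2), ∫ x in Metric.ball x0 R, V x t ^ (-(1 / (p - 1)))) := by
  have hp := hpq.lt
  have hq := hpq.symm.lt
  have hpc := prof_continuous x0 R
  set φ : EuclideanSpace ℝ (Fin n) → ℝ := fun x => prof x0 R x ^ 3 with hφ
  have hφc : Continuous φ := hpc.pow 3
  have hφ0 : ∀ x, 0 ≤ φ x := fun x => pow_nonneg (prof_nonneg _ _ _) 3
  have hφ1 : ∀ x, φ x ≤ 1 := fun x => pow_le_one₀ (prof_nonneg _ _ _) (prof_le_one _ _ _)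
  have hφz : ∀ x ∉ Metric.ball x0 R, φ x = 0 := fun x hx => by simp [hφ, prof_eq_zero hR hx]
  have hφz' : ∀ x ∉ Metric.closedBall x0 R, φ x = 0 := fun x hx => by
    simp [hφ, prof_eq_zero' hR hx]
  have hslice : ∀ {g : EuclideanSpace ℝ (Fin n) → ℝ → ℝ},
      ContinuousOn (fun q : EuclideanSpace ℝ (Fin n) × ℝ => g q.1 q.2)
      {q : EuclideanSpace ℝ (Fin n) × ℝ | 0 < q.2} → ∀ t, 0 < t → Continuous (fun x => g x t) :=
    fun {g} hg t ht => hg.comp_continuous (f := fun x => (x, t)) (by fun_prop) (fun x => ht)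
  have hu_cont' := hu_cont.mono (fun (q : EuclideanSpace ℝ (Fin n) × ℝ) (hq : 0 < q.2) => hq.le)
  have hparam : ∀ {g : EuclideanSpace ℝ (Fin n) → ℝ → ℝ},
      ContinuousOn (fun q : EuclideanSpace ℝ (Fin n) × ℝ => g q.1 q.2)
      {q : EuclideanSpace ℝ (Fin n) × ℝ | 0 < q.2} →
      ContinuousOn (fun t => ∫ x, g x t * φ x) (Ioi 0) := by
    intro g hg
    refine continuousOn_integral_of_compact_support (isCompact_closedBall x0 R)
      (f := fun t x => g x t * φ x) ?_ ?_
    · have h1 : ContinuousOn (fun q : ℝ × EuclideanSpace ℝ (Fin n) => g q.2 q.1)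
          (Ioi 0 ×ˢ univ) :=
        hg.comp (f := fun q : ℝ × EuclideanSpace ℝ (Fin n) => (q.2, q.1)) (by fun_prop)
          (fun q hq => hq.1)
      exact h1.mul (hφc.comp continuous_snd).continuousOn
    · intro t x _ hx
      simp [hφz' x hx]
  have hInteg : ∀ {w : EuclideanSpace ℝ (Fin n) → ℝ}, Continuous w →
      Integrable (fun x => w x * φ x) := fun {w} hw =>
    integrable_of_zero_off (x0 := x0) (R := R) (hw.mul hφc) (fun x hx => by simp [hφz' x hx])
  set F : ℝ → ℝ := fun t => ∫ x, u x t * φ x with hF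
  set G : ℝ → ℝ := fun t => ∫ x, (u x t ^ p * V x t) * φ x with hG
  set H : ℝ → ℝ := fun t => ∫ x, deriv (fun s => u x s) t * φ x with hH
  have hFc : ContinuousOn F (Ioi 0) := hparam hu_cont'
  have hGc : ContinuousOn G (Ioi 0) := hparam (g := fun x t => u x t ^ p * V x t) hf_cont
  have hfc := fun t ht => hslice (g := fun x t => u x t ^ p * V x t) hf_cont t ht
  have huc := fun t ht => hslice hu_cont' t ht
  have hlapc : ∀ t, 0 < t → Continuous (fun x => laplacian (fun y => u y t) x) := by
    intro t ht
    have hv := hu_space t ht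
    have hf1 : ContDiff ℝ 1 (fderiv ℝ (fun y => u y t)) := hv.fderiv_right (by norm_num)
    unfold laplacian
    refine continuous_finsetSum _ fun i _ => ?_
    exact ((hf1.clm_apply contDiff_const).continuous_fderiv (by norm_num)).clm_apply
      continuous_const
  have hfnn : ∀ x t, 0 < t → 0 ≤ u x t ^ p * V x t := fun x t ht =>
    mul_nonneg (Real.rpow_nonneg (hu_nonneg x t ht.le) p) (hV_pos x t ht).le
  have hsup : ∀ x, ∀ t : ℝ, 0 < t →
      laplacian (fun y => u y t) x ≤ deriv (fun s => u x s) t := by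
    intro x t ht
    rw [hpde x t ht]; linarith [hfnn x t ht]
  have hF0 : ∀ t, 0 < t → 0 ≤ F t := fun t ht =>
    integral_nonneg fun x => mul_nonneg (hu_nonneg x t ht.le) (hφ0 x)
  have hG0 : ∀ t, 0 < t → 0 ≤ G t := fun t ht =>
    integral_nonneg fun x => mul_nonneg (hfnn x t ht) (hφ0 x)
  set μ : ℝ := (4 + n) ^ 2 / R ^ 2 with hμ
  have hμ0 : 0 ≤ μ := by positivity
  have hHge : ∀ t, 0 < t → -μ * F t + G t ≤ H t := by
    intro t ht
    have h1 := integral_laplacian_ge x0 hR (hu_space t ht) (fun x => hu_nonneg x t ht.le)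
    have h2 : H t = (∫ x, laplacian (fun y => u y t) x * φ x) + G t := by
      rw [hH, hG]
      simp only
      rw [← integral_add (hInteg (hlapc t ht)) (hInteg (hfc t ht))]
      congr 1
      funext x
      rw [hpde x t ht]; ring
    rw [h2]
    linarith
  have hdini : ∀ t, 0 < t → ∀ r, r < H t → ∀ᶠ z in 𝓝[>] t, r < slope F t z := by
    intro t ht r hr
    refine dini_lower hu_cont hu_space hu_time hsup x0 hR ht ?_ r hr
    have : (fun x => deriv (fun s => u x s) t) =
        fun x => laplacian (fun y => u y t) x + u x t ^ p * V x t := funext fun x => hpde x t ht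
    rw [this]
    exact (hlapc t ht).add (hfc t ht)
  set a : ℝ := R ^ 2 / 4 with ha
  set b : ℝ := R ^ 2 with hb
  have hapos : 0 < a := by positivity
  have hab : a < b := by rw [ha]; linarith [show 0 < b by positivity]
  have hexp : ∀ t, HasDerivAt (fun t => Real.exp (μ * t)) (μ * Real.exp (μ * t)) t := by
    intro t
    have := ((hasDerivAt_id t).const_mul μ).exp
    exact this.congr_deriv (by simp; ring)
  -- first step: times in [ε, a]
  have step1 : ∫ t in ε..a, G t ≤ Real.exp (μ * a) * F a := by
    have h1 := weight_ineq (F := F) (H := H) (w := fun t => Real.exp (μ * t))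
      (w' := fun t => μ * Real.exp (μ * t)) (L := G) hε hεR hFc hdini hexp
      (fun t _ => (Real.exp_pos _).le) hGc (by
        intro t ht
        have ht0 : 0 < t := hε.trans_le ht.1
        have e1 : 1 ≤ Real.exp (μ * t) := Real.one_le_exp (by positivity)
        have e2 := hHge t ht0
        have e3 := hG0 t ht0
        nlinarith)
    have h2 : 0 ≤ Real.exp (μ * ε) * F ε := mul_nonneg (Real.exp_pos _).le (hF0 ε hε)
    linarith
  -- second step: times in [a, b]
  set c : ℝ := q / (b - a) with hc
  have hc0 : 0 ≤ c := div_nonneg (by linarith) (by linarith)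
  set χ : ℝ → ℝ := fun t => (b - t) / (b - a) with hχ
  have hχ0 : ∀ t ∈ Icc a b, 0 ≤ χ t := fun t ht =>
    div_nonneg (by linarith [ht.2]) (by linarith)
  have hχd : ∀ t, HasDerivAt χ (-(1 / (b - a))) t := by
    intro t
    have := ((hasDerivAt_id t).const_sub b).div_const (b - a)
    exact this.congr_deriv (by ring)
  have hχc : Continuous χ := continuous_iff_continuousAt.2 fun t => (hχd t).continuousAt
  set L : ℝ → ℝ := fun t => Real.exp (μ * t) * (χ t ^ q * G t - c * χ t ^ (q - 1) * F t) with hL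
  have hLc : ContinuousOn L (Ioi 0) := by
    have h1 : Continuous (fun t => χ t ^ q) := hχc.rpow_const (fun t => Or.inr (by linarith))
    have h2 : Continuous (fun t => c * χ t ^ (q - 1)) :=
      continuous_const.mul (hχc.rpow_const (fun t => Or.inr (by linarith)))
    have h3 : Continuous (fun t => Real.exp (μ * t)) := by fun_prop
    exact h3.continuousOn.mul ((h1.continuousOn.mul hGc).sub (h2.continuousOn.mul hFc))
  have step2 : Real.exp (μ * a) * F a ≤ ∫ t in a..b, -L t := by
    have h1 := weight_ineq (F := F) (H := H) (w := fun t => Real.exp (μ * t) * χ t ^ q)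
      (w' := fun t => Real.exp (μ * t) * (μ * χ t ^ q - c * χ t ^ (q - 1))) (L := L)
      hapos hab.le hFc hdini (by
        intro t
        have := (hexp t).mul ((hχd t).rpow_const (p := q) (Or.inr hq.le))
        refine this.congr_deriv ?_
        rw [hc]; ring)
      (fun t ht => mul_nonneg (Real.exp_pos _).le (Real.rpow_nonneg (hχ0 t ht) _)) hLc (by
        intro t ht
        have ht0 : 0 < t := hapos.trans_le ht.1
        have e2 := hHge t ht0
        have e3 : 0 ≤ Real.exp (μ * t) * χ t ^ q :=
          mul_nonneg (Real.exp_pos _).le (Real.rpow_nonneg (hχ0 t ⟨ht.1, ht.2.le⟩) _)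
        have e4 := mul_le_mul_of_nonneg_left e2 e3
        simp only [hL]
        linarith)
    have hχb : χ b = 0 := by simp [hχ]
    have hχa : χ a = 1 := by
      simp only [hχ]; exact div_self (by linarith)
    simp only [hχb, hχa, Real.one_rpow, Real.zero_rpow (show q ≠ 0 by linarith)] at h1
    rw [intervalIntegral.integral_neg]
    linarith
  have hWcont : ContinuousOn (fun q : EuclideanSpace ℝ (Fin n) × ℝ =>
      V q.1 q.2 ^ (-(1 / (p - 1)))) {q : EuclideanSpace ℝ (Fin n) × ℝ | 0 < q.2} :=
    hV_cont.rpow_const (fun q hq => Or.inl (hV_pos q.1 q.2 hq).ne')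
  have hWint : IntegrableOn (fun q : EuclideanSpace ℝ (Fin n) × ℝ =>
      V q.1 q.2 ^ (-(1 / (p - 1)))) (Metric.ball x0 R ×ˢ Ioc a b) := by
    have : IntegrableOn (fun q : EuclideanSpace ℝ (Fin n) × ℝ =>
      V q.1 q.2 ^ (-(1 / (p - 1)))) (Metric.closedBall x0 R ×ˢ Icc a b) :=
      (hWcont.mono (fun q hq => hapos.trans_le hq.2.1)).integrableOn_compact
        ((isCompact_closedBall x0 R).prod isCompact_Icc)
    exact this.mono_set (Set.prod_mono Metric.ball_subset_closedBall Ioc_subset_Icc_self)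
  have hKint : IntegrableOn (fun t => ∫ x in Metric.ball x0 R, V x t ^ (-(1 / (p - 1))))
      (Ioc a b) := by
    rw [IntegrableOn, Measure.volume_eq_prod, ← Measure.prod_restrict] at hWint
    exact hWint.integral_prod_right
  have step3 : ∫ t in a..b, -L t ≤ Real.exp ((4 + n) ^ 2) * (c ^ q *
      ∫ t in Ioc a b, ∫ x in Metric.ball x0 R, V x t ^ (-(1 / (p - 1)))) := by
    rw [intervalIntegral.integral_of_le hab.le, ← integral_const_mul, ← integral_const_mul]
    refine setIntegral_mono_on ?_ ((hKint.const_mul _).const_mul _) measurableSet_Ioc ?_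
    · exact ((hLc.mono (fun t ht => hapos.trans_le ht.1)).neg.integrableOn_compact
        isCompact_Icc).mono_set Ioc_subset_Icc_self
    · intro t ht
      have ht0 : 0 < t := hapos.trans ht.1
      have hWt : IntegrableOn (fun x => V x t ^ (-(1 / (p - 1)))) (Metric.ball x0 R) :=
        ((hslice (g := fun x t => V x t ^ (-(1 / (p - 1)))) hWcont t
          ht0).continuousOn.integrableOn_compact (isCompact_closedBall x0 R)).mono_set
          Metric.ball_subset_closedBall
      have hVr : ∀ x, 0 ≤ V x t ^ (-(1 / (p - 1))) := fun x =>
        Real.rpow_nonneg (hV_pos x t ht0).le _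
      have hcq : 0 ≤ c ^ q := Real.rpow_nonneg hc0 _
      have h1 : c * χ t ^ (q - 1) * F t - χ t ^ q * G t ≤
          c ^ q * ∫ x in Metric.ball x0 R, V x t ^ (-(1 / (p - 1))) := by
        have i1 := (hInteg (huc t ht0)).const_mul (c * χ t ^ (q - 1))
        have i2 := (hInteg (hfc t ht0)).const_mul (χ t ^ q)
        rw [hF, hG]
        simp only
        rw [← integral_const_mul, ← integral_const_mul, ← integral_const_mul, ← integral_sub i1 i2,
          ← setIntegral_eq_integral_of_forall_compl_eq_zero (s := Metric.ball x0 R)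
            (fun x hx => by simp [hφz x hx])]
        refine setIntegral_mono (i1.sub i2).integrableOn (hWt.const_mul _) ?_
        intro x
        have y := young_pointwise hpq (hu_nonneg x t ht0.le) (hV_pos x t ht0)
          (hχ0 t ⟨ht.1.le, ht.2⟩) hc0
        have y2 := mul_le_mul_of_nonneg_right y (hφ0 x)
        have y3 := mul_le_mul_of_nonneg_left (hφ1 x) (mul_nonneg hcq (hVr x))
        simp only
        linarith
      have h2 : Real.exp (μ * t) ≤ Real.exp ((4 + n) ^ 2) := by
        apply Real.exp_le_exp.2
        calc μ * t ≤ μ * b := mul_le_mul_of_nonneg_left ht.2 hμ0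
          _ = (4 + n) ^ 2 := by rw [hμ, hb]; field_simp
      have h3 : 0 ≤ c ^ q * ∫ x in Metric.ball x0 R, V x t ^ (-(1 / (p - 1))) :=
        mul_nonneg hcq (integral_nonneg hVr)
      calc -L t = Real.exp (μ * t) * (c * χ t ^ (q - 1) * F t - χ t ^ q * G t) := by
            simp only [hL]; ring
        _ ≤ Real.exp (μ * t) *
            (c ^ q * ∫ x in Metric.ball x0 R, V x t ^ (-(1 / (p - 1)))) :=
            mul_le_mul_of_nonneg_left h1 (Real.exp_pos _).le
        _ ≤ _ := mul_le_mul_of_nonneg_right h2 h3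
  exact step1.trans (step2.trans step3)

/-- In the critical case `p = 1 + 2/α`, for a nonnegative classical solution of
`u_t = Δu + u^p V` on `ℝⁿ × (0,∞)` with `V` positive, continuous and satisfying the (VOL)
conditions with exponent `α`, the integral `∫_{ℝⁿ × (0,∞)} V u^p` is finite. -/
theorem critical_case_integral_finite
    {n : ℕ} (p α : ℝ) (hα : 0 < α) (hp : p = 1 + 2 / α)
    (u V : EuclideanSpace ℝ (Fin n) → ℝ → ℝ)
    -- u is continuous up to t = 0
    (hu_cont : ContinuousOn (fun q : EuclideanSpace ℝ (Fin n) × ℝ => u q.1 q.2)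
      {q : EuclideanSpace ℝ (Fin n) × ℝ | 0 ≤ q.2})
    -- u is C² in the space variable for every t > 0
    (hu_space : ∀ t : ℝ, 0 < t → ContDiff ℝ 2 (fun x => u x t))
    -- u is C¹ in the time variable on (0,∞)
    (hu_time : ∀ x, ContDiffOn ℝ 1 (fun s => u x s) (Ioi 0))
    -- V is continuous on ℝⁿ × (0,∞)
    (hV_cont : ContinuousOn (fun q : EuclideanSpace ℝ (Fin n) × ℝ => V q.1 q.2)
      {q : EuclideanSpace ℝ (Fin n) × ℝ | 0 < q.2})
    -- V is positive
    (hV_pos : ∀ x, ∀ t : ℝ, 0 < t → 0 < V x t)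
    -- u is nonnegative
    (hu_nonneg : ∀ x, ∀ t : ℝ, 0 ≤ t → 0 ≤ u x t)
    -- u solves u_t = Δu + u^p V on ℝⁿ × (0,∞)
    (hpde : ∀ x, ∀ t : ℝ, 0 < t →
      deriv (fun s => u x s) t = laplacian (fun y => u y t) x + u x t ^ p * V x t)
    -- the conditions (VOL) with exponent α
    (hVOL : ∃ x₀ : EuclideanSpace ℝ (Fin n), ∃ C R₀ : ℝ, 0 < C ∧ 0 < R₀ ∧
      ∀ R : ℝ, R₀ ≤ R →
        (∫ t in Ioc (R ^ 2 / 4) (R ^ 2), ∫ x in Metric.ball x₀ R,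
            V x t ^ (-(1 / (p - 1)))) ≤ C * R ^ (2 + α) ∧
        (∫ t in Ioc (0 : ℝ) (R ^ 2), ∫ x in Metric.ball x₀ R \ Metric.ball x₀ (R / 2),
            V x t ^ (-(1 / (p - 1)))) ≤ C * R ^ (2 + α)) :
    ∫⁻ q in {q : EuclideanSpace ℝ (Fin n) × ℝ | 0 < q.2},
        ENNReal.ofReal (V q.1 q.2 * u q.1 q.2 ^ p) < ⊤ := by
  have hp1 : 1 < p := by rw [hp]; linarith [div_pos two_pos hα]
  set q : ℝ := 1 + α / 2 with hqdef
  have hpq : p.HolderConjugate q := by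
    rw [Real.holderConjugate_iff]
    refine ⟨hp1, ?_⟩
    rw [hp, hqdef]
    field_simp
    ring
  have hq1 := hpq.symm.lt
  obtain ⟨x₀, C, R₀, hC, hR₀, hvol⟩ := hVOL
  have hu_cont' := hu_cont.mono (fun (q : EuclideanSpace ℝ (Fin n) × ℝ) (hq : 0 < q.2) => hq.le)
  have hf_cont : ContinuousOn (fun q : EuclideanSpace ℝ (Fin n) × ℝ => u q.1 q.2 ^ p * V q.1 q.2)
      {q : EuclideanSpace ℝ (Fin n) × ℝ | 0 < q.2} :=
    (hu_cont'.rpow_const (fun q _ => Or.inr (by linarith))).mul hV_cont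
  have hfnn : ∀ x t, 0 < t → 0 ≤ u x t ^ p * V x t := fun x t ht =>
    mul_nonneg (Real.rpow_nonneg (hu_nonneg x t ht.le) p) (hV_pos x t ht).le
  have hu_time' : ∀ x, ∀ t : ℝ, 0 < t → DifferentiableAt ℝ (fun s => u x s) t := fun x t ht =>
    ((hu_time x).differentiableOn (by norm_num)).differentiableAt (Ioi_mem_nhds ht)
  set M : ℝ := Real.exp ((4 + n) ^ 2) * ((4 * q / 3) ^ q * C) with hM
  have hcore : ∀ R ε : ℝ, R₀ ≤ R → 0 < ε → ε ≤ R ^ 2 / 4 →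
      ∫ t in ε..(R ^ 2 / 4), ∫ x, (u x t ^ p * V x t) * prof x₀ R x ^ 3 ≤ M := by
    intro R ε hR hε hεR
    have hRpos : 0 < R := hR₀.trans_le hR
    refine (core_bound p q hpq u V hu_cont hu_space hu_time' hV_cont hV_pos hu_nonneg hpde hf_cont
      x₀ hRpos hε hεR).trans ?_
    have hnn : 0 ≤ q / (R ^ 2 - R ^ 2 / 4) := by
      have : 0 < R ^ 2 := by positivity
      exact div_nonneg (by linarith) (by linarith)
    rw [hM]
    refine mul_le_mul_of_nonneg_left ?_ (Real.exp_pos _).le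
    refine (mul_le_mul_of_nonneg_left (hvol R hR).1 (Real.rpow_nonneg hnn _)).trans (le_of_eq ?_)
    have e1 : q / (R ^ 2 - R ^ 2 / 4) = (4 * q / 3) * (R ^ 2)⁻¹ := by field_simp; ring
    have e2 : (R ^ 2) ^ q = R ^ (2 + α) := by
      rw [← Real.rpow_natCast, ← Real.rpow_mul hRpos.le]
      congr 1
      rw [hqdef]; push_cast; ring
    rw [e1, Real.mul_rpow (by linarith) (by positivity), Real.inv_rpow (by positivity), e2]
    have : R ^ (2 + α) ≠ 0 := (Real.rpow_pos_of_pos hRpos _).ne'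
    field_simp
  set r : ℕ → ℝ := fun m => R₀ + 2 + m with hr
  have hrm : ∀ m, 2 ≤ r m := fun m => by
    have : (0:ℝ) ≤ m := Nat.cast_nonneg m
    simp only [hr]; linarith
  have hrR : ∀ m, R₀ ≤ r m := fun m => by
    have : (0:ℝ) ≤ m := Nat.cast_nonneg m
    simp only [hr]; linarith
  have hrmono : Monotone r := fun i j hij => by
    have : (i:ℝ) ≤ j := Nat.cast_le.2 hij
    simp only [hr]; linarith
  set S : ℕ → Set (EuclideanSpace ℝ (Fin n) × ℝ) := fun m =>
    Metric.closedBall x₀ (r m / 2) ×ˢ Ioc (1 / r m) (r m ^ 2 / 4) with hS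
  have hSmono : Monotone S := by
    intro i j hij
    have h1 := hrmono hij
    have h2 := hrm i
    refine Set.prod_mono (Metric.closedBall_subset_closedBall (by linarith)) (Ioc_subset_Ioc ?_ ?_)
    · exact one_div_le_one_div_of_le (by linarith) h1
    · have : r i ^ 2 ≤ r j ^ 2 := pow_le_pow_left₀ (by linarith) h1 2
      linarith
  have hunion : {q : EuclideanSpace ℝ (Fin n) × ℝ | 0 < q.2} ⊆ ⋃ m, S m := by
    rintro ⟨x, t⟩ ht
    have ht : 0 < t := ht
    obtain ⟨m, hm⟩ := exists_nat_ge (2 * dist x x₀ + 1 / t + 2 * t)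
    have hd := dist_nonneg (x := x) (y := x₀)
    have hti : 0 < 1 / t := by positivity
    have hmr : (m:ℝ) + 2 < r m := by simp only [hr]; linarith
    refine mem_iUnion.2 ⟨m, ?_, ?_, ?_⟩
    · rw [Metric.mem_closedBall]; simp only; linarith
    · simp only
      rw [one_div_lt (by linarith [hrm m]) ht]; linarith
    · simp only
      nlinarith [hrm m]
  have hSbound : ∀ m, ∫⁻ q in S m, ENNReal.ofReal (V q.1 q.2 * u q.1 q.2 ^ p) ≤
      ENNReal.ofReal (64 / 27 * M) := by
    intro m
    have h2 := hrm m
    have hrpos : 0 < r m := by linarith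
    have hεpos : 0 < 1 / r m := by positivity
    have hεle : 1 / r m ≤ r m ^ 2 / 4 := by
      have : 1 / r m ≤ 1 / 2 := one_div_le_one_div_of_le two_pos h2
      nlinarith
    have hSmeas : MeasurableSet (S m) :=
      Metric.isClosed_closedBall.measurableSet.prod measurableSet_Ioc
    have hSpos : ∀ q ∈ S m, 0 < q.2 := fun q hq => hεpos.trans hq.2.1
    have hInteg : IntegrableOn (fun q : EuclideanSpace ℝ (Fin n) × ℝ => u q.1 q.2 ^ p * V q.1 q.2)
        (S m) := by
      have : IntegrableOn (fun q : EuclideanSpace ℝ (Fin n) × ℝ => u q.1 q.2 ^ p * V q.1 q.2)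
          (Metric.closedBall x₀ (r m / 2) ×ˢ Icc (1 / r m) (r m ^ 2 / 4)) :=
        (hf_cont.mono (fun q hq => hεpos.trans_le hq.2.1)).integrableOn_compact
          ((isCompact_closedBall _ _).prod isCompact_Icc)
      exact this.mono_set (Set.prod_mono subset_rfl Ioc_subset_Icc_self)
    have hcomm : (fun q : EuclideanSpace ℝ (Fin n) × ℝ =>
        ENNReal.ofReal (V q.1 q.2 * u q.1 q.2 ^ p)) =
        fun q => ENNReal.ofReal (u q.1 q.2 ^ p * V q.1 q.2) := by
      funext q; rw [mul_comm]
    rw [hcomm, ← ofReal_integral_eq_lintegral_ofReal hInteg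
      ((ae_restrict_iff' hSmeas).2 (Eventually.of_forall fun q hq => hfnn q.1 q.2 (hSpos q hq)))]
    refine ENNReal.ofReal_le_ofReal ?_
    have hInteg' := hInteg
    rw [IntegrableOn, Measure.volume_eq_prod, ← Measure.prod_restrict] at hInteg'
    have hfub : ∫ q in S m, u q.1 q.2 ^ p * V q.1 q.2 = ∫ t in Ioc (1 / r m) (r m ^ 2 / 4),
        ∫ x in Metric.closedBall x₀ (r m / 2), u x t ^ p * V x t := by
      rw [Measure.volume_eq_prod, ← Measure.prod_restrict]
      exact integral_prod_symm _ hInteg'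
    rw [hfub]
    have hGc : ContinuousOn (fun t => ∫ x, (u x t ^ p * V x t) * prof x₀ (r m) x ^ 3)
        (Ioi 0) := by
      refine continuousOn_integral_of_compact_support (isCompact_closedBall x₀ (r m))
        (f := fun t x => (u x t ^ p * V x t) * prof x₀ (r m) x ^ 3) ?_ ?_
      · have h1 : ContinuousOn (fun q : ℝ × EuclideanSpace ℝ (Fin n) =>
            u q.2 q.1 ^ p * V q.2 q.1) (Ioi 0 ×ˢ univ) :=
          hf_cont.comp (f := fun q : ℝ × EuclideanSpace ℝ (Fin n) => (q.2, q.1)) (by fun_prop)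
            (fun q hq => hq.1)
        exact h1.mul (((prof_continuous x₀ (r m)).pow 3).comp continuous_snd).continuousOn
      · intro t x _ hx
        simp [prof_eq_zero' hrpos hx]
    have hGint : IntegrableOn (fun t => ∫ x, (u x t ^ p * V x t) * prof x₀ (r m) x ^ 3)
        (Ioc (1 / r m) (r m ^ 2 / 4)) :=
      ((hGc.mono (fun t ht => hεpos.trans_le ht.1)).integrableOn_compact
        isCompact_Icc).mono_set Ioc_subset_Icc_self
    have hcb := hcore (r m) (1 / r m) (hrR m) hεpos hεle
    rw [intervalIntegral.integral_of_le hεle] at hcb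
    refine le_trans ?_ (mul_le_mul_of_nonneg_left hcb (by norm_num : (0:ℝ) ≤ 64 / 27))
    rw [← integral_const_mul]
    refine setIntegral_mono_on hInteg'.integral_prod_right (hGint.const_mul _) measurableSet_Ioc ?_
    intro t ht
    have ht0 : 0 < t := hεpos.trans ht.1
    have hft : Continuous (fun x => u x t ^ p * V x t) :=
      hf_cont.comp_continuous (f := fun x => (x, t)) (by fun_prop) (fun x => ht0)
    have hGi : Integrable (fun x => 64 / 27 * ((u x t ^ p * V x t) * prof x₀ (r m) x ^ 3)) :=
      (integrable_of_zero_off (x0 := x₀) (R := r m)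
        (hft.mul ((prof_continuous x₀ (r m)).pow 3))
        (fun x hx => by simp [prof_eq_zero' hrpos hx])).const_mul _
    rw [← integral_const_mul]
    refine le_trans ?_ (setIntegral_le_integral (s := Metric.closedBall x₀ (r m / 2)) hGi
      (Eventually.of_forall fun x => mul_nonneg (by norm_num) (mul_nonneg (hfnn x t ht0)
        (pow_nonneg (prof_nonneg _ _ _) 3))))
    refine setIntegral_mono_on (hft.continuousOn.integrableOn_compact (isCompact_closedBall _ _))
      hGi.integrableOn Metric.isClosed_closedBall.measurableSet ?_
    intro x hx
    have hxn : ‖x - x₀‖ ≤ r m / 2 := by simpa [dist_eq_norm] using hx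
    have hprof : 3 / 4 ≤ prof x₀ (r m) x := by
      refine le_trans ?_ (le_max_left _ _)
      have : ‖x - x₀‖ ^ 2 / r m ^ 2 ≤ 1 / 4 := by
        rw [div_le_iff₀ (by positivity)]
        nlinarith [norm_nonneg (x - x₀)]
      linarith
    have h3 : (3 / 4 : ℝ) ^ 3 ≤ prof x₀ (r m) x ^ 3 := pow_le_pow_left₀ (by norm_num) hprof 3
    have h4 := mul_le_mul_of_nonneg_left h3 (hfnn x t ht0)
    linarith
  calc ∫⁻ q in {q : EuclideanSpace ℝ (Fin n) × ℝ | 0 < q.2},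
        ENNReal.ofReal (V q.1 q.2 * u q.1 q.2 ^ p)
      ≤ ∫⁻ q in ⋃ m, S m, ENNReal.ofReal (V q.1 q.2 * u q.1 q.2 ^ p) :=
        lintegral_mono_set hunion
    _ = ⨆ m, ∫⁻ q in S m, ENNReal.ofReal (V q.1 q.2 * u q.1 q.2 ^ p) :=
        setLIntegral_iUnion_of_directed _ hSmono.directed_le
    _ ≤ ENNReal.ofReal (64 / 27 * M) := iSup_le hSbound
    _ < ⊤ := ENNReal.ofReal_lt_top
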